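/- Suppose q is not a root of unity. The map P ↦ θ(T(P)) is a bijection (a permutation) of the finite set H-Spec(O_q(G(m,n))) of H-prime ideals of O_q(G(m,n)); i.e., θ(T(H-Spec(O_q(G(m,n))))) = H-Spec(O_q(G(m,n))). Consequently, for any H-prime P, a quantum minor [i_1,…,i_m] lies in P if and only if [i_1+1,…,i_m+1] (with i_m+1 read as 1 when i_m=n) lies in θ(T(P)); the sets of quantum minors contained in H-primes are permuted by cycling with (12…n). -/

import Mathlib

open scoped BigOperators

namespace QG

variable (K : Type*) [Field K]

/-- The defining relations of the quantum matrix algebra `O_q(M_{m,n})`. -/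
inductive QMatRel (q : K) (m n : ℕ) :
    FreeAlgebra K (Fin m × Fin n) → FreeAlgebra K (Fin m × Fin n) → Prop
  | row : ∀ (i : Fin m) (j l : Fin n), j < l →
      QMatRel q m n (FreeAlgebra.ι K (i, j) * FreeAlgebra.ι K (i, l))
        (q • (FreeAlgebra.ι K (i, l) * FreeAlgebra.ι K (i, j)))
  | col : ∀ (i k : Fin m) (j : Fin n), i < k →
      QMatRel q m n (FreeAlgebra.ι K (i, j) * FreeAlgebra.ι K (k, j))
        (q • (FreeAlgebra.ι K (k, j) * FreeAlgebra.ι K (i, j)))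
  | comm : ∀ (i k : Fin m) (j l : Fin n), k < i → j < l →
      QMatRel q m n (FreeAlgebra.ι K (i, j) * FreeAlgebra.ι K (k, l))
        (FreeAlgebra.ι K (k, l) * FreeAlgebra.ι K (i, j))
  | qrel : ∀ (i k : Fin m) (j l : Fin n), i < k → j < l →
      QMatRel q m n
        (FreeAlgebra.ι K (i, j) * FreeAlgebra.ι K (k, l) -
          FreeAlgebra.ι K (k, l) * FreeAlgebra.ι K (i, j))
        ((q - q⁻¹) • (FreeAlgebra.ι K (i, l) * FreeAlgebra.ι K (k, j)))

/-- The quantum matrix algebra `O_q(M_{m,n})`. -/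
abbrev QMat (q : K) (m n : ℕ) := RingQuot (QMatRel K q m n)

/-- The generator `X_{ij}` of `O_q(M_{m,n})`. -/
noncomputable def X (q : K) {m n : ℕ} (i : Fin m) (j : Fin n) : QMat K q m n :=
  RingQuot.mkAlgHom K (QMatRel K q m n) (FreeAlgebra.ι K (i, j))

/-- The number of inversions (Coxeter length) of a permutation of `Fin t`. -/
def invCount {t : ℕ} (σ : Equiv.Perm (Fin t)) : ℕ :=
  ((Finset.univ : Finset (Fin t × Fin t)).filter fun p => p.1 < p.2 ∧ σ p.2 < σ p.1).card

/-- The quantum minor `Σ_σ (-q)^{ℓ(σ)} x_{σ(1)1} ⋯ x_{σ(t)t}` of a `t × t`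
matrix of elements of a `K`-algebra. -/
noncomputable def qMinor {A : Type*} [Ring A] [Algebra K A] (q : K) (t : ℕ)
    (x : Fin t → Fin t → A) : A :=
  ∑ σ : Equiv.Perm (Fin t), ((-q) ^ invCount σ) • (List.ofFn fun k => x (σ k) k).prod

/-- The maximal (`m × m`) quantum minor `[J]` of `O_q(M_{m,n})`, with column index set `J`
(columns taken in increasing order, rows `1,…,m`).  (Defined to be `0` if `J` does not
have exactly `m` elements.) -/
noncomputable def grMinor (q : K) (m : ℕ) {n : ℕ} (J : Finset (Fin n)) : QMat K q m n :=
  if h : J.card = m then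
    qMinor K q m (fun i k => X K q i (J.orderEmbOfFin h k)) else 0

/-- The set of maximal quantum minors of `O_q(M_{m,n})`. -/
def grGenSet (q : K) (m n : ℕ) : Set (QMat K q m n) :=
  {a | ∃ J : Finset (Fin n), a = grMinor K q m J}

/-- The quantum grassmannian `O_q(G(m,n))`: the subalgebra of `O_q(M_{m,n})`
generated by the maximal quantum minors. -/
noncomputable def qGrass (q : K) (m n : ℕ) : Subalgebra K (QMat K q m n) :=
  Algebra.adjoin K (grGenSet K q m n)

/-- The maximal quantum minor `[J]` viewed as an element of the quantum grassmannian. -/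
noncomputable def grE (q : K) (m : ℕ) {n : ℕ} (J : Finset (Fin n)) : ↥(qGrass K q m n) :=
  ⟨grMinor K q m J, Algebra.subset_adjoin ⟨J, rfl⟩⟩

/-- Reduction of a natural number modulo `n`, landing in `Fin n` (this encodes the
paper's convention that a column index is read modulo `n`; indices here are 0-based). -/
def fmod (n : ℕ) (hn : 0 < n) (k : ℕ) : Fin n := ⟨k % n, Nat.mod_lt k hn⟩

/-- The index set `{α, α+1, …, α+m-1}` (read modulo `n`) of a consecutive quantum minor
(0-based indices). -/
def consecSet {n : ℕ} (hn : 0 < n) (m : ℕ) (α : ℕ) : Finset (Fin n) :=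
  (Finset.range m).image fun k => fmod n hn (α + k)

end QG
namespace QG

variable (K : Type*) [Field K]

/-- Localisation of a `K`-algebra `A` at the powers of a normal element `u`:
an algebra `B` together with an injective map `A → B` inverting `u`, such that every
element of `B` has the form `a·u^{-k}`. -/
structure NormalLoc (A : Type*) [Ring A] [Algebra K A]
    (B : Type*) [Ring B] [Algebra K B] (u : A) where
  emb : A →ₐ[K] B
  inj : Function.Injective emb
  isUnit : IsUnit (emb u)
  surj : ∀ b : B, ∃ (a : A) (k : ℕ), b = emb a * ↑(isUnit.unit⁻¹ ^ k)

/-- The index set (0-based) of the quantum minor defining the dehomogenisation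
generator `x_{ij}` at the consecutive minor starting at `α`:
`M_α ∪ {~(α+m+j)} ∖ {~(α+(m-1-i))}`. -/
def JxSet {n : ℕ} (hn : 0 < n) (m : ℕ) (α : ℕ) (i : Fin m) (j : Fin (n - m)) :
    Finset (Fin n) :=
  insert (fmod n hn (α + m + j)) ((consecSet hn m α).erase (fmod n hn (α + (m - 1 - i))))

/-- The generator `x_{ij} = [M_α ∪ {~(α+m+j)} ∖ {~(α+(m-1-i))}]·M_α^{-1}` of the
dehomogenisation of the quantum grassmannian at the consecutive minor `M_α`. -/
noncomputable def xElt (q : K) (m n : ℕ) (hn : 0 < n) (α : ℕ)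
    {B : Type*} [Ring B] [Algebra K B]
    (L : NormalLoc K (↥(qGrass K q m n)) B (grE K q m (consecSet hn m α)))
    (i : Fin m) (j : Fin (n - m)) : B :=
  L.emb (grE K q m (JxSet hn m α i j)) * ↑(L.isUnit.unit⁻¹)

/-- `B` is a skew-Laurent extension `R[y^{±1};σ]` of the subalgebra `R`, where `σ` is
conjugation by the unit `y`:  `R` is stable under conjugation by `y` and `B` is free as a
left `R`-module with basis the (integer) powers of `y`. -/
def IsSkewLaurent {B : Type*} [Ring B] [Algebra K B] (R : Subalgebra K B) (y : Bˣ) : Prop :=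
  (∀ r ∈ R, (y : B) * r * ((y⁻¹ : Bˣ) : B) ∈ R) ∧
    ∀ b : B, ∃! f : ℤ →₀ ↥R, b = f.sum fun k r => (r : B) * ((y ^ k : Bˣ) : B)

/-- The quantum minor of a matrix of elements with row index set `R` and column index
set `C` (rows and columns taken in increasing order); `0` if the cardinalities differ. -/
noncomputable def finsetMinor {B : Type*} [Ring B] [Algebra K B] (q : K) {m c : ℕ}
    (x : Fin m → Fin c → B) (R : Finset (Fin m)) (C : Finset (Fin c)) : B :=
  if h : C.card = R.card then
    qMinor K q R.card (fun a b => x (R.orderEmbOfFin rfl a) (C.orderEmbOfFin h b))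
  else 0

/-- The row set `(α+m) − (M_α ∖ I_r)` (0-based) of the image of the maximal minor `[I]`
under the dehomogenisation at `M_α`. -/
def rowSetOf {n : ℕ} (hn : 0 < n) (m : ℕ) (α : ℕ) (I : Finset (Fin n)) : Finset (Fin m) :=
  (Finset.univ.filter fun k : Fin m => fmod n hn (α + k) ∉ I).image Fin.rev

/-- The column set `I_c − (α+m−1)` (0-based) of the image of the maximal minor `[I]`
under the dehomogenisation at `M_α`. -/
def colSetOf {n : ℕ} (hn : 0 < n) (m : ℕ) (α : ℕ) (I : Finset (Fin n)) :
    Finset (Fin (n - m)) :=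
  Finset.univ.filter fun d : Fin (n - m) => fmod n hn (α + m + d) ∈ I

/-- The last index (0-based, corresponding to the paper's index `n`). -/
def lastIdx (n : ℕ) (hn : 0 < n) : Fin n := ⟨n - 1, by omega⟩

/-- The 2-cocycle `c((s_1,…,s_n),(t_1,…,t_n)) = ∏_{j ≠ n} p^{s_n t_j}` on `ℤ^n`. -/
noncomputable def cmap {n : ℕ} (hn : 0 < n) (p : K) :
    (Fin n → ℤ) → (Fin n → ℤ) → K := fun s t =>
  ∏ j ∈ Finset.univ.filter (fun j : Fin n => j ≠ lastIdx n hn),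
    p ^ (s (lastIdx n hn) * t j)

/-- The content `ε(j+m) − ε(m+1−i)` of the dehomogenisation generator `x_{ij}`
(0-based: `ε(m+j) − ε(m-1-i)`). -/
def xContent (m n : ℕ) (i : Fin m) (j : Fin (n - m)) : Fin n → ℤ := fun l =>
  (if (l : ℕ) = m + j then 1 else 0) - (if (l : ℕ) = m - 1 - i then 1 else 0)

/-- The content `ε(1) + ⋯ + ε(m)` of `y` (equivalently, of a consecutive minor `M_1`). -/
def yContent (m n : ℕ) : Fin n → ℤ := fun l => if (l : ℕ) < m then 1 else 0

/-- The content `Σ_{i ∈ I} ε(i)` of a maximal quantum minor `[I]`. -/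
def contentOf {n : ℕ} (I : Finset (Fin n)) : Fin n → ℤ := fun l => if l ∈ I then 1 else 0

/-- A realization of the twist `T(A)` of a `ℤ^n`-graded `K`-algebra `A` by a
2-cocycle `c`: a `K`-algebra `T` together with a `K`-linear isomorphism `τ : A ≃ T`
(the twist map `a ↦ a'`) satisfying `a'b' = c(s,t)·(ab)'` on homogeneous elements. -/
structure CocycleTwist {n : ℕ} (A : Type*) [Ring A] [Algebra K A]
    (𝒜 : (Fin n → ℤ) → Submodule K A) (c : (Fin n → ℤ) → (Fin n → ℤ) → K)
    (T : Type*) [Ring T] [Algebra K T] where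
  τ : A ≃ₗ[K] T
  mul_tw : ∀ (s t : Fin n → ℤ) (a b : A), a ∈ 𝒜 s → b ∈ 𝒜 t →
    τ a * τ b = c s t • τ (a * b)

/-- The image of an index set under the cycle `(1 2 … n)` (0-based). -/
def shiftSet {n : ℕ} (hn : 0 < n) (I : Finset (Fin n)) : Finset (Fin n) :=
  I.image fun a : Fin n => fmod n hn (a.val + 1)

end QG
namespace QG

variable (K : Type*) [Field K]

/-- The set of `H`-prime ideals of `O_q(G(m,n))`: the proper, two-sided, completely
prime ideals that are homogeneous for the content `ℤ^n`-grading (`H = (K^*)^n` acts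
through the grading, and for `q` not a root of unity primes are completely prime). -/
def HSpecSet (q : K) (m n : ℕ)
    (𝒜 : (Fin n → ℤ) → Submodule K ↥(qGrass K q m n)) [GradedAlgebra 𝒜] :
    Set (Ideal ↥(qGrass K q m n)) :=
  {P | P ≠ ⊤ ∧ (∀ a ∈ P, ∀ r, a * r ∈ P) ∧
    (∀ a b : ↥(qGrass K q m n), a * b ∈ P → a ∈ P ∨ b ∈ P) ∧
    ∀ (s : Fin n → ℤ), ∀ a ∈ P,
      ((DirectSum.decompose 𝒜 a s : 𝒜 s) : ↥(qGrass K q m n)) ∈ P}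

section HPGeneric

variable {K : Type*} [Field K] {A : Type*} [Ring A] [Algebra K A] {n : ℕ}
  (𝒜 : (Fin n → ℤ) → Submodule K A) [GradedAlgebra 𝒜]

/-- `H`-prime condition, generic version. -/
def IsHP (P : Ideal A) : Prop :=
  P ≠ ⊤ ∧ (∀ a ∈ P, ∀ r, a * r ∈ P) ∧
    (∀ a b : A, a * b ∈ P → a ∈ P ∨ b ∈ P) ∧
    ∀ (s : Fin n → ℤ), ∀ a ∈ P, ((DirectSum.decompose 𝒜 a s : 𝒜 s) : A) ∈ P

theorem exists_top_comp (Q : Ideal A) (a : A) (ha : a ∉ Q) :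
    ∃ s : Fin n → ℤ, (DirectSum.decompose 𝒜 a s : A) ∉ Q ∧
      ∀ u, toLex s < toLex u → (DirectSum.decompose 𝒜 a u : A) ∈ Q := by
  classical
  let S := (DirectSum.decompose 𝒜 a).support.filter
    (fun s => (DirectSum.decompose 𝒜 a s : A) ∉ Q)
  have hS : S.Nonempty := by
    by_contra h
    apply ha
    rw [← DirectSum.sum_support_decompose 𝒜 a]
    refine Submodule.sum_mem _ fun i hi => ?_
    by_contra h2
    exact h ⟨i, Finset.mem_filter.2 ⟨hi, h2⟩⟩
  obtain ⟨s, hs, hmax⟩ := S.exists_max_image (fun s => toLex s) hS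
  refine ⟨s, (Finset.mem_filter.1 hs).2, fun u hu => ?_⟩
  by_contra h
  have hu' : u ∈ S := by
    refine Finset.mem_filter.2 ⟨?_, h⟩
    rw [DFinsupp.mem_support_toFun]
    intro h0
    apply h
    rw [h0]
    exact Q.zero_mem
  exact absurd (hmax u hu') (not_le.2 hu)

theorem completelyPrime_of_homogeneous (Q : Ideal A) (h2 : ∀ a ∈ Q, ∀ r, a * r ∈ Q)
    (hh : ∀ s, ∀ a ∈ Q, (DirectSum.decompose 𝒜 a s : A) ∈ Q)
    (hp : ∀ s t a b, a ∈ 𝒜 s → b ∈ 𝒜 t → a * b ∈ Q → a ∈ Q ∨ b ∈ Q) :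
    ∀ a b, a * b ∈ Q → a ∈ Q ∨ b ∈ Q := by
  classical
  intro a b hab
  by_contra hcon
  push Not at hcon
  obtain ⟨s, hs, hsmax⟩ := exists_top_comp 𝒜 Q a hcon.1
  obtain ⟨t, ht, htmax⟩ := exists_top_comp 𝒜 Q b hcon.2
  have key : (DirectSum.decompose 𝒜 (a * b) (s + t) : A) ∈ Q := hh _ _ hab
  have hnn : (DirectSum.decompose 𝒜 a s : A) * (DirectSum.decompose 𝒜 b t : A) ∉ Q := by
    intro h
    rcases hp s t _ _ (SetLike.coe_mem _) (SetLike.coe_mem _) h with h | h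
    · exact hs h
    · exact ht h
  apply hnn
  set F := (DirectSum.decompose 𝒜 a).support ×ˢ (DirectSum.decompose 𝒜 b).support with hF
  have hmem : (s, t) ∈ F := by
    rw [hF, Finset.mem_product]
    constructor <;> rw [DFinsupp.mem_support_toFun] <;> intro h0
    · apply hs; rw [h0]; exact Q.zero_mem
    · apply ht; rw [h0]; exact Q.zero_mem
  have hprod : a * b = ∑ x ∈ F, (DirectSum.decompose 𝒜 a x.1 : A) *
      (DirectSum.decompose 𝒜 b x.2 : A) := by
    rw [hF, Finset.sum_product]
    dsimp only
    rw [← Finset.sum_mul_sum, DirectSum.sum_support_decompose,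
      DirectSum.sum_support_decompose]
  have hproj : (DirectSum.decompose 𝒜 (a * b) (s + t) : A) =
      ∑ x ∈ F, (DirectSum.decompose 𝒜 ((DirectSum.decompose 𝒜 a x.1 : A) *
      (DirectSum.decompose 𝒜 b x.2 : A)) (s + t) : A) := by
    rw [hprod]
    simp only [← GradedRing.proj_apply, map_sum]
  have hst : (DirectSum.decompose 𝒜 ((DirectSum.decompose 𝒜 a s : A) *
      (DirectSum.decompose 𝒜 b t : A)) (s + t) : A) = (DirectSum.decompose 𝒜 a s : A) *
      (DirectSum.decompose 𝒜 b t : A) :=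
    DirectSum.decompose_of_mem_same 𝒜 (SetLike.mul_mem_graded (SetLike.coe_mem _) (SetLike.coe_mem _))
  rw [← hst]
  rw [hproj, ← Finset.add_sum_erase _ _ hmem] at key
  refine (Submodule.add_mem_iff_left _ ?_).1 key
  refine Submodule.sum_mem _ fun x hx => ?_
  obtain ⟨u, v⟩ := x
  have hne : (u, v) ≠ (s, t) := (Finset.mem_erase.1 hx).1
  by_cases huv : u + v = s + t
  · apply hh
    rcases lt_trichotomy (toLex s) (toLex u) with h | h | h
    · exact h2 _ (hsmax u h) _
    · exfalso
      apply hne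
      have h' : s = u := toLex.injective h
      subst h'
      rw [add_left_cancel huv]
    · apply Q.mul_mem_left
      apply htmax
      have h3 : toLex u + toLex v = toLex s + toLex t := by
        rw [← toLex_add, huv, toLex_add]
      by_contra h4
      exact absurd h3 (ne_of_lt (add_lt_add_of_lt_of_le h (not_lt.1 h4)))
  · rw [DirectSum.decompose_of_mem_ne 𝒜
      (SetLike.mul_mem_graded (SetLike.coe_mem _) (SetLike.coe_mem _)) huv]
    exact Q.zero_mem

/-- A twisted graded linear automorphism. -/
structure TwAut (σ : (Fin n → ℤ) ≃ (Fin n → ℤ)) (ψ : A ≃ₗ[K] A) : Prop where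
  grd : ∀ s, ∀ a ∈ 𝒜 s, ψ a ∈ 𝒜 (σ s)
  mul : ∀ s t a b, a ∈ 𝒜 s → b ∈ 𝒜 t → ∃ d : K, d ≠ 0 ∧ ψ a * ψ b = d • ψ (a * b)

variable {𝒜}

theorem TwAut.decomp {σ : (Fin n → ℤ) ≃ (Fin n → ℤ)} {ψ : A ≃ₗ[K] A} (h : TwAut 𝒜 σ ψ)
    (s : Fin n → ℤ) (a : A) :
    (DirectSum.decompose 𝒜 (ψ a) (σ s) : A) = ψ (DirectSum.decompose 𝒜 a s : A) := by
  classical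
  induction a using DirectSum.Decomposition.inductionOn 𝒜 with
  | zero => simp
  | @homogeneous i x =>
    by_cases his : i = s
    · subst his
      rw [DirectSum.decompose_of_mem_same 𝒜 (h.grd _ _ x.2),
        DirectSum.decompose_of_mem_same 𝒜 x.2]
    · rw [DirectSum.decompose_of_mem_ne 𝒜 (h.grd _ _ x.2) (fun e => his (σ.injective e)),
        DirectSum.decompose_of_mem_ne 𝒜 x.2 his, map_zero]
  | add x y hx hy =>
    simp only [map_add, DirectSum.decompose_add, DirectSum.add_apply, Submodule.coe_add] at *
    rw [hx, hy]

theorem TwAut.grd_iff {σ : (Fin n → ℤ) ≃ (Fin n → ℤ)} {ψ : A ≃ₗ[K] A} (h : TwAut 𝒜 σ ψ)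
    (s : Fin n → ℤ) (a : A) : ψ a ∈ 𝒜 (σ s) ↔ a ∈ 𝒜 s := by
  refine ⟨fun ha => ?_, h.grd s a⟩
  have h1 := h.decomp s a
  rw [DirectSum.decompose_of_mem_same 𝒜 ha] at h1
  rw [ψ.injective h1]
  exact SetLike.coe_mem _

theorem TwAut.symm {σ : (Fin n → ℤ) ≃ (Fin n → ℤ)} {ψ : A ≃ₗ[K] A} (h : TwAut 𝒜 σ ψ) :
    TwAut 𝒜 σ.symm ψ.symm := by
  have hg : ∀ s, ∀ a ∈ 𝒜 s, ψ.symm a ∈ 𝒜 (σ.symm s) := by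
    intro s a ha
    rw [← h.grd_iff]
    simpa using ha
  refine ⟨hg, fun s t a b ha hb => ?_⟩
  obtain ⟨d, hd, he⟩ := h.mul _ _ _ _ (hg _ _ ha) (hg _ _ hb)
  refine ⟨d⁻¹, inv_ne_zero hd, ?_⟩
  simp only [LinearEquiv.apply_symm_apply] at he
  rw [he, map_smul, LinearEquiv.symm_apply_apply, smul_smul, inv_mul_cancel₀ hd, one_smul]

theorem smul_mem_left_ideal (P : Ideal A) (d : K) {a : A} (ha : a ∈ P) : d • a ∈ P := by
  rw [← one_mul a, ← smul_mul_assoc]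
  exact P.mul_mem_left _ ha

theorem TwAut.mul_mem {σ : (Fin n → ℤ) ≃ (Fin n → ℤ)} {ψ : A ≃ₗ[K] A} (h : TwAut 𝒜 σ ψ)
    {P : Ideal A} (hP : IsHP 𝒜 P) (a b : A) (hab : a ∈ P ∨ b ∈ P) :
    ψ.symm (ψ a * ψ b) ∈ P := by
  classical
  rw [← DirectSum.sum_support_decompose 𝒜 a, ← DirectSum.sum_support_decompose 𝒜 b]
  rw [map_sum, map_sum, Finset.sum_mul_sum, map_sum]
  refine Submodule.sum_mem _ fun i _ => ?_
  rw [map_sum]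
  refine Submodule.sum_mem _ fun j _ => ?_
  obtain ⟨d, hd, he⟩ := h.mul i j _ _ (SetLike.coe_mem (DirectSum.decompose 𝒜 a i))
    (SetLike.coe_mem (DirectSum.decompose 𝒜 b j))
  rw [he, map_smul, LinearEquiv.symm_apply_apply]
  apply smul_mem_left_ideal
  rcases hab with ha | hb
  · exact hP.2.1 _ (hP.2.2.2 _ _ ha) _
  · exact P.mul_mem_left _ (hP.2.2.2 _ _ hb)

theorem TwAut.image {σ : (Fin n → ℤ) ≃ (Fin n → ℤ)} {ψ : A ≃ₗ[K] A} (h : TwAut 𝒜 σ ψ)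
    {P : Ideal A} (hP : IsHP 𝒜 P) :
    ∃ Q : Ideal A, IsHP 𝒜 Q ∧ (Q : Set A) = ψ '' (P : Set A) := by
  let Q : Ideal A :=
    { carrier := {x | ψ.symm x ∈ P}
      zero_mem' := by simp
      add_mem' := fun {x y} hx hy => by
        simp only [Set.mem_ofPred_eq, map_add] at *
        exact P.add_mem hx hy
      smul_mem' := fun c x hx => by
        have := h.mul_mem hP (ψ.symm c) (ψ.symm x) (Or.inr hx)
        simpa using this }
  have hQ : ∀ x, x ∈ Q ↔ ψ.symm x ∈ P := fun x => Iff.rfl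
  have h2 : ∀ a ∈ Q, ∀ r, a * r ∈ Q := by
    intro a ha r
    have := h.mul_mem hP (ψ.symm a) (ψ.symm r) (Or.inl ha)
    rw [hQ]
    simpa using this
  have hh : ∀ s, ∀ a ∈ Q, (DirectSum.decompose 𝒜 a s : A) ∈ Q := by
    intro s a ha
    have h3 := h.symm.decomp s a
    rw [hQ, ← h3]
    exact hP.2.2.2 _ _ ha
  refine ⟨Q, ⟨?_, h2, ?_, hh⟩, ?_⟩
  · intro ht
    apply hP.1
    rw [Ideal.eq_top_iff_one]
    have : ψ 1 ∈ Q := by rw [ht]; trivial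
    rw [hQ] at this
    simpa using this
  · refine completelyPrime_of_homogeneous 𝒜 Q h2 hh ?_
    intro s t a b ha hb hab
    obtain ⟨d, hd, he⟩ := h.symm.mul s t a b ha hb
    apply hP.2.2.1
    rw [he]
    exact smul_mem_left_ideal P d hab
  · ext x
    constructor
    · intro hx
      exact ⟨ψ.symm x, hx, by simp⟩
    · rintro ⟨y, hy, rfl⟩
      change ψ.symm (ψ y) ∈ P
      simpa using hy

/-- Gradedness can be checked on homogeneous generators. -/
theorem grd_of_gens (σ : (Fin n → ℤ) ≃+ (Fin n → ℤ)) (ψ : A ≃ₗ[K] A)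
    (mul : ∀ s t a b, a ∈ 𝒜 s → b ∈ 𝒜 t → ∃ d : K, d ≠ 0 ∧ ψ a * ψ b = d • ψ (a * b))
    (h1 : ψ 1 = 1) (G : Set A) (hG : Algebra.adjoin K G = ⊤)
    (hgen : ∀ g ∈ G, ∃ s, g ∈ 𝒜 s ∧ ψ g ∈ 𝒜 (σ s)) : TwAut 𝒜 σ.toEquiv ψ := by
  classical
  refine ⟨?_, mul⟩
  have hmon : ∀ g ∈ Submonoid.closure G, ∃ s, g ∈ 𝒜 s ∧ ψ g ∈ 𝒜 (σ s) := by
    intro g hg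
    induction hg using Submonoid.closure_induction with
    | mem x hx => exact hgen x hx
    | one =>
      refine ⟨0, SetLike.GradedOne.one_mem, ?_⟩
      rw [h1, map_zero]
      exact SetLike.GradedOne.one_mem
    | mul x y _ _ hx hy =>
      obtain ⟨s, hs, hs'⟩ := hx
      obtain ⟨t, ht, ht'⟩ := hy
      refine ⟨s + t, SetLike.mul_mem_graded hs ht, ?_⟩
      obtain ⟨d, hd, he⟩ := mul s t x y hs ht
      have h3 : ψ (x * y) = d⁻¹ • (ψ x * ψ y) := by
        rw [he, smul_smul, inv_mul_cancel₀ hd, one_smul]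
      rw [h3, map_add]
      exact Submodule.smul_mem _ _ (SetLike.mul_mem_graded hs' ht')
  have hall : ∀ a : A, ∀ s, ψ (DirectSum.decompose 𝒜 a s : A) ∈ 𝒜 (σ s) := by
    intro a
    have ha : a ∈ Submodule.span K (Submonoid.closure G : Set A) := by
      rw [← Algebra.adjoin_eq_span, hG]
      trivial
    induction ha using Submodule.span_induction with
    | mem x hx =>
      intro s
      obtain ⟨t, ht, ht'⟩ := hmon x hx
      by_cases hts : t = s
      · subst hts
        rwa [DirectSum.decompose_of_mem_same 𝒜 ht]
      · rw [DirectSum.decompose_of_mem_ne 𝒜 ht hts, map_zero]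
        exact Submodule.zero_mem _
    | zero => intro s; simp
    | add x y _ _ hx hy =>
      intro s
      simp only [DirectSum.decompose_add, DirectSum.add_apply, Submodule.coe_add, map_add]
      exact Submodule.add_mem _ (hx s) (hy s)
    | smul c x _ hx =>
      intro s
      rw [DirectSum.decompose_smul, DirectSum.smul_apply, Submodule.coe_smul, map_smul]
      exact Submodule.smul_mem _ _ (hx s)
  intro s a ha
  have := hall a s
  rwa [DirectSum.decompose_of_mem_same 𝒜 ha] at this

end HPGeneric

/-- The cyclic shift of indices, as a permutation. -/
noncomputable def cyc (n : ℕ) (hn : 0 < n) : Equiv.Perm (Fin n) :=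
  Equiv.ofBijective (fun a : Fin n => fmod n hn (a.val + 1)) (by
    rw [← Finite.injective_iff_bijective]
    intro a b hab
    have h : (a.val + 1) % n = (b.val + 1) % n := congrArg Fin.val hab
    have h2 : a.val ≡ b.val [MOD n] := Nat.ModEq.add_right_cancel' 1 h
    exact Fin.ext (Nat.ModEq.eq_of_lt_of_lt h2 a.2 b.2))

/-- The induced automorphism of the grading group. -/
noncomputable def cycG (n : ℕ) (hn : 0 < n) : (Fin n → ℤ) ≃+ (Fin n → ℤ) :=
  { Equiv.arrowCongr (cyc n hn) (Equiv.refl ℤ) with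
    map_add' := fun _ _ => rfl }

theorem cycG_content (n : ℕ) (hn : 0 < n) (J : Finset (Fin n)) :
    cycG n hn (contentOf J) = contentOf (shiftSet hn J) := by
  funext l
  have h1 : cycG n hn (contentOf J) l = contentOf J ((cyc n hn).symm l) := rfl
  have h2 : (cyc n hn).symm l ∈ J ↔ l ∈ shiftSet hn J := by
    unfold shiftSet
    rw [Finset.mem_image]
    constructor
    · intro h
      exact ⟨_, h, (cyc n hn).apply_symm_apply l⟩
    · rintro ⟨a, ha, rfl⟩
      have : (cyc n hn).symm (cyc n hn a) = a := (cyc n hn).symm_apply_apply a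
      change (cyc n hn).symm (cyc n hn a) ∈ J
      rwa [this]
  rw [h1]
  simp only [contentOf, h2]

theorem card_shiftSet (n : ℕ) (hn : 0 < n) (J : Finset (Fin n)) :
    (shiftSet hn J).card = J.card :=
  Finset.card_image_of_injective _ (cyc n hn).injective

theorem cmap_ne_zero {K : Type*} [Field K] {n : ℕ} (hn : 0 < n) (p : K) (hp : p ≠ 0)
    (s t : Fin n → ℤ) : cmap K hn p s t ≠ 0 :=
  Finset.prod_ne_zero_iff.2 fun _ _ => zpow_ne_zero _ hp

/-- Suppose `q` is not a root of unity.  The assignment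
`P ↦ θ(T(P))` permutes the finite set `H-Spec(O_q(G(m,n)))`:
`θ(T(H-Spec)) = H-Spec`.  Consequently, for any `H`-prime `P`, a quantum minor
`[i_1,…,i_m]` lies in `P` if and only if `[i_1+1,…,i_m+1]` (indices modulo `n`) lies
in `θ(T(P))`;  the sets of quantum minors contained in `H`-primes are permuted by
cycling with `(1 2 … n)`. -/
theorem H_primes_permuted_by_cycling
    (q : K) (hq : q ≠ 0) (hroot : ∀ k : ℕ, 0 < k → q ^ k ≠ 1)
    (m n : ℕ) (hm : 0 < m) (hmn : m < n)
    (p : K) (hp : p ^ m = q ^ 2)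
    (𝒜 : (Fin n → ℤ) → Submodule K ↥(qGrass K q m n)) [GradedAlgebra 𝒜]
    (hhom : ∀ J : Finset (Fin n), J.card = m → grE K q m J ∈ 𝒜 (contentOf J))
    (T : Type*) [Ring T] [Algebra K T]
    (tw : CocycleTwist K (↥(qGrass K q m n)) 𝒜 (cmap K (show 0 < n by omega) p) T)
    (θ : T ≃ₐ[K] ↥(qGrass K q m n))
    (hθ : ∀ J : Finset (Fin n), J.card = m →
      (lastIdx n (show 0 < n by omega) ∉ J →
        θ (tw.τ (grE K q m J)) = grE K q m (shiftSet (show 0 < n by omega) J)) ∧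
      (lastIdx n (show 0 < n by omega) ∈ J →
        θ (tw.τ (grE K q m J)) =
          q ^ (-2 : ℤ) • grE K q m (shiftSet (show 0 < n by omega) J))) :
    {S : Set ↥(qGrass K q m n) | ∃ P ∈ HSpecSet K q m n 𝒜,
        S = (fun a => θ (tw.τ a)) '' (P : Set ↥(qGrass K q m n))} =
      {S : Set ↥(qGrass K q m n) | ∃ P ∈ HSpecSet K q m n 𝒜,
        S = (P : Set ↥(qGrass K q m n))} ∧
    ∀ P ∈ HSpecSet K q m n 𝒜, ∀ J : Finset (Fin n), J.card = m →
      (grE K q m J ∈ P ↔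
        grE K q m (shiftSet (show 0 < n by omega) J) ∈
          (fun a => θ (tw.τ a)) '' (P : Set ↥(qGrass K q m n))) := by
  have hn : 0 < n := by omega
  have hp0 : p ≠ 0 := by
    rintro rfl
    rw [zero_pow hm.ne'] at hp
    exact pow_ne_zero 2 hq hp.symm
  let ψ : ↥(qGrass K q m n) ≃ₗ[K] ↥(qGrass K q m n) := tw.τ.trans θ.toLinearEquiv
  have hψ : ∀ a, ψ a = θ (tw.τ a) := fun a => rfl
  have hmul : ∀ s t a b, a ∈ 𝒜 s → b ∈ 𝒜 t →
      ∃ d : K, d ≠ 0 ∧ ψ a * ψ b = d • ψ (a * b) := by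
    intro s t a b ha hb
    refine ⟨_, cmap_ne_zero hn p hp0 s t, ?_⟩
    rw [hψ, hψ, hψ, ← map_mul, tw.mul_tw s t a b ha hb, map_smul]
  have hτ1 : ∀ x : ↥(qGrass K q m n), tw.τ 1 * tw.τ x = tw.τ x := by
    intro x
    induction x using DirectSum.Decomposition.inductionOn 𝒜 with
    | zero => simp
    | @homogeneous i y =>
      rw [tw.mul_tw 0 i 1 y SetLike.GradedOne.one_mem y.2]
      simp [cmap]
    | add x y hx hy => rw [map_add, mul_add, hx, hy]
  have hτ1' : tw.τ 1 = 1 := by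
    have := hτ1 (tw.τ.symm 1)
    simpa using this
  have h1 : ψ 1 = 1 := by rw [hψ, hτ1', map_one]
  have hq2 : (q ^ (-2 : ℤ)) ≠ 0 := zpow_ne_zero _ hq
  have hgen : ∀ J : Finset (Fin n), J.card = m →
      ∃ d : K, d ≠ 0 ∧ ψ (grE K q m J) = d • grE K q m (shiftSet hn J) := by
    intro J hJ
    by_cases hl : lastIdx n hn ∈ J
    · exact ⟨_, hq2, (hθ J hJ).2 hl⟩
    · exact ⟨1, one_ne_zero, by rw [one_smul]; exact (hθ J hJ).1 hl⟩
  have hTw : TwAut (K := K) (A := ↥(qGrass K q m n)) 𝒜 (cycG n hn).toEquiv ψ := by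
    refine grd_of_gens (K := K) (A := ↥(qGrass K q m n)) (cycG n hn) ψ hmul h1
      ((Subtype.val : ↥(qGrass K q m n) → QMat K q m n) ⁻¹' grGenSet K q m n)
      (Algebra.adjoin_adjoin_coe_preimage) ?_
    rintro g ⟨J, hJ⟩
    have hg : g = grE K q m J := Subtype.ext hJ
    by_cases hc : J.card = m
    · refine ⟨contentOf J, hg ▸ hhom J hc, ?_⟩
      obtain ⟨d, _, he⟩ := hgen J hc
      rw [hg, he, cycG_content]
      exact Submodule.smul_mem _ _ (hhom _ (by rw [card_shiftSet, hc]))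
    · have h0 : g = 0 := by
        apply Subtype.ext
        rw [hJ]
        simp [grMinor, hc]
      exact ⟨(0 : Fin n → ℤ), by rw [h0]; exact (𝒜 0).zero_mem,
        by rw [h0, LinearEquiv.map_zero ψ]; exact (𝒜 _).zero_mem⟩
  refine ⟨?_, ?_⟩
  · ext S
    constructor
    · rintro ⟨P, hP, rfl⟩
      obtain ⟨Q, hQ, he⟩ := hTw.image (P := P) hP
      exact ⟨Q, hQ, he.symm⟩
    · rintro ⟨P, hP, rfl⟩
      obtain ⟨Q, hQ, he⟩ := hTw.symm.image (P := P) hP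
      refine ⟨Q, hQ, ?_⟩
      change (P : Set ↥(qGrass K q m n)) = ψ '' (Q : Set ↥(qGrass K q m n))
      rw [he, Set.image_image]
      simp
  · intro P hP J hJ
    have hsm : ∀ (d : K) {a : ↥(qGrass K q m n)}, a ∈ P → d • a ∈ P := by
      intro d a ha
      have h3 := P.mul_mem_left (algebraMap K ↥(qGrass K q m n) d) ha
      rwa [← Algebra.smul_def] at h3
    obtain ⟨d, hd, he⟩ := hgen J hJ
    have he' : ψ (d⁻¹ • grE K q m J) = grE K q m (shiftSet hn J) := by
      rw [map_smul, he, smul_smul, inv_mul_cancel₀ hd, one_smul]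
    constructor
    · intro h
      exact ⟨_, hsm d⁻¹ h, he'⟩
    · rintro ⟨x, hx, hxe⟩
      have : x = d⁻¹ • grE K q m J := ψ.injective (hxe.trans he'.symm)
      have h2 : d • x = grE K q m J := by
        rw [this, smul_smul, mul_inv_cancel₀ hd, one_smul]
      rw [← h2]
      exact hsm d hx
end QG
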